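/- arXiv:2104.14084 — 2 statements merged into one kernel-verified Lean document; each statement's English description precedes it below -/
import Mathlib

section
/- For every ε ∈ (0,1], define B : ℝ² × [0,∞) → ℝ³ by B(x₁,x₂,t) := (ε sin x₂, 0, 1 + ε cos(x₁) exp(−ε² sin²(x₂) t)). Then lim_{t→∞} [ (∫_{−π}^{π} ∫_{−π}^{π} Σ_{i∈{1,2}} Σ_{j∈{1,2,3}} (∂_{x_i} B_j(x₁,x₂,t))² dx₁ dx₂)^{1/2} ] / [ (2π³)^{1/4} ε^{3/2} t^{1/4} ] = 1. In particular the spatial-gradient L² norm of B(·,t) over [−π,π]² grows like ε^{3/2} t^{1/4} as t → ∞, even though B(·,t) is uniformly bounded. -/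
open Real Filter MeasureTheory

lemma integral_sq_mul_exp_neg_sq : ∫ y : ℝ, y ^ 2 * exp (-y ^ 2) = √π / 2 := by
  have h := integral_comp_abs (f := fun y : ℝ => y ^ 2 * exp (-y ^ 2))
  have hΓ : Gamma (3 / 2) = √π / 2 := by
    rw [show (3 / 2 : ℝ) = 1 / 2 + 1 by norm_num, Gamma_add_one (by norm_num), Gamma_one_half_eq]
    ring
  have hI := integral_rpow_mul_exp_neg_rpow (p := 2) (q := 2) (by norm_num) (by norm_num)
  simp only [rpow_two] at hI
  rw [show ((2 : ℝ) + 1) / 2 = 3 / 2 by norm_num, hΓ] at hI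
  simp only [sq_abs] at h
  rw [h, hI]
  ring

lemma mul_sin_div_eq_mul_sinc {b : ℝ} (hb : b ≠ 0) (y : ℝ) :
    b * sin (y / b) = y * sinc (y / b) := by
  rcases eq_or_ne y 0 with rfl | hy
  · simp
  · rw [sinc_of_ne_zero (div_ne_zero hy hb)]
    field_simp

lemma tendsto_mul_sin_div_atTop (y : ℝ) :
    Tendsto (fun b : ℝ => b * sin (y / b)) atTop (nhds y) := by
  have h : Tendsto (fun b : ℝ => y / b) atTop (nhds 0) := tendsto_const_nhds.div_atTop tendsto_id
  have h' : Tendsto (fun b : ℝ => y * sinc (y / b)) atTop (nhds (y * 1)) := by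
    rw [← sinc_zero]
    exact ((continuous_sinc.tendsto 0).comp h).const_mul y
  rw [mul_one] at h'
  refine h'.congr' ?_
  filter_upwards [eventually_gt_atTop 0] with b hb
  rw [mul_sin_div_eq_mul_sinc hb.ne']

lemma abs_sq_mul_exp_neg_sq_sin_div_le {b y : ℝ} (hb : 0 < b) (hy : |y| ≤ b * (π / 2)) :
    |(b * sin (y / b)) ^ 2 * cos (y / b) ^ 2 * exp (-(b * sin (y / b)) ^ 2)| ≤
      y ^ 2 * exp (-(2 / π) ^ 2 * y ^ 2) := by
  have hyb : |y / b| ≤ π / 2 := by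
    rw [abs_div, abs_of_pos hb, div_le_iff₀ hb]
    linarith
  have hlow : (2 / π) ^ 2 * y ^ 2 ≤ (b * sin (y / b)) ^ 2 := by
    rw [← mul_pow, sq_le_sq, abs_mul, abs_mul, abs_of_pos hb,
      abs_of_pos (show (0 : ℝ) < 2 / π by positivity)]
    calc 2 / π * |y| = b * (2 / π * |y / b|) := by
          rw [abs_div, abs_of_pos hb]; field_simp
      _ ≤ b * |sin (y / b)| := by gcongr; exact mul_abs_le_abs_sin hyb
  have hup : (b * sin (y / b)) ^ 2 ≤ y ^ 2 := by
    calc (b * sin (y / b)) ^ 2 = b ^ 2 * sin (y / b) ^ 2 := by ring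
      _ ≤ b ^ 2 * (y / b) ^ 2 := by gcongr ?_ * ?_; exact sin_sq_le_sq
      _ = y ^ 2 := by field_simp
  rw [abs_of_nonneg (by positivity)]
  have hc : (b * sin (y / b)) ^ 2 * cos (y / b) ^ 2 ≤ y ^ 2 :=
    (mul_le_of_le_one_right (sq_nonneg _) (cos_sq_le_one _)).trans hup
  gcongr
  linarith

lemma tendsto_integral_sin_sq_half_period :
    Tendsto (fun b : ℝ => b ^ 3 * ∫ x in (-(π / 2))..(π / 2),
      sin x ^ 2 * cos x ^ 2 * exp (-b ^ 2 * sin x ^ 2)) atTop (nhds (√π / 2)) := by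
  let F : ℝ → ℝ → ℝ := fun b y =>
    (b * sin (y / b)) ^ 2 * cos (y / b) ^ 2 * exp (-(b * sin (y / b)) ^ 2)
  let G : ℝ → ℝ → ℝ := fun b => (Set.Ioc (-(b * (π / 2))) (b * (π / 2))).indicator (F b)
  have hG : Tendsto (fun b => ∫ y, G b y) atTop (nhds (∫ y, y ^ 2 * exp (-y ^ 2))) := by
    refine tendsto_integral_filter_of_dominated_convergence
      (fun y => y ^ 2 * exp (-(2 / π) ^ 2 * y ^ 2)) ?_ ?_ ?_ ?_
    · refine Eventually.of_forall fun b => ?_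
      have hF : Continuous (F b) := by fun_prop
      exact hF.aestronglyMeasurable.indicator measurableSet_Ioc
    · filter_upwards [eventually_gt_atTop 0] with b hb
      refine ae_of_all _ fun y => ?_
      by_cases hy : y ∈ Set.Ioc (-(b * (π / 2))) (b * (π / 2))
      · simp only [G, Set.indicator_of_mem hy, norm_eq_abs]
        exact abs_sq_mul_exp_neg_sq_sin_div_le hb (abs_le.2 ⟨hy.1.le, hy.2⟩)
      · simp only [G, Set.indicator_of_notMem hy, norm_zero]
        positivity
    · have h := integrable_rpow_mul_exp_neg_mul_sq
        (show 0 < (2 / π) ^ 2 by positivity) (show (-1 : ℝ) < 2 by norm_num)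
      simpa only [rpow_two] using h
    · refine ae_of_all _ fun y => ?_
      have hs := tendsto_mul_sin_div_atTop y
      have hc : Tendsto (fun b : ℝ => cos (y / b)) atTop (nhds 1) := by
        rw [← cos_zero]
        exact (continuous_cos.tendsto 0).comp (tendsto_const_nhds.div_atTop tendsto_id)
      have hlim : Tendsto (fun b => F b y) atTop (nhds (y ^ 2 * 1 ^ 2 * exp (-y ^ 2))) :=
        ((hs.pow 2).mul (hc.pow 2)).mul ((continuous_exp.tendsto _).comp (hs.pow 2).neg)
      rw [one_pow, mul_one] at hlim
      refine hlim.congr' ?_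
      filter_upwards [eventually_gt_atTop (|y| / (π / 2))] with b hb
      rw [div_lt_iff₀ (by positivity), abs_lt] at hb
      exact (Set.indicator_of_mem (Set.mem_Ioc.2 ⟨hb.1, hb.2.le⟩) _).symm
  rw [integral_sq_mul_exp_neg_sq] at hG
  refine hG.congr' ?_
  filter_upwards [eventually_gt_atTop 0] with b hb
  have hle : -(b * (π / 2)) ≤ b * (π / 2) := by
    have : 0 < b * (π / 2) := by positivity
    linarith
  have hcomp := intervalIntegral.integral_comp_div (a := -(b * (π / 2))) (b := b * (π / 2))
    (fun x => b ^ 2 * (sin x ^ 2 * cos x ^ 2 * exp (-b ^ 2 * sin x ^ 2))) hb.ne'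
  rw [neg_div, mul_div_cancel_left₀ _ hb.ne', smul_eq_mul] at hcomp
  rw [integral_indicator measurableSet_Ioc, ← intervalIntegral.integral_of_le hle,
    pow_succ' b 2, mul_assoc, ← intervalIntegral.integral_const_mul, ← hcomp]
  refine intervalIntegral.integral_congr fun y _ => ?_
  simp only [F]
  ring_nf

lemma integral_neg_pi_pi_eq_two_mul {f : ℝ → ℝ} (hf : Function.Periodic f π)
    (hfc : Continuous f) : ∫ x in (-π)..π, f x = 2 * ∫ x in (-(π / 2))..(π / 2), f x := by
  have h₁ := hf.intervalIntegral_add_eq (-π) (-(π / 2))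
  have h₂ := hf.intervalIntegral_add_eq 0 (-(π / 2))
  rw [show -(π / 2) + π = π / 2 by ring] at h₁ h₂
  rw [neg_add_cancel] at h₁
  rw [zero_add] at h₂
  rw [← intervalIntegral.integral_add_adjacent_intervals (hfc.intervalIntegrable (-π) 0)
    (hfc.intervalIntegrable 0 π), h₁, h₂]
  ring

lemma tendsto_integral_sin_sq_mul_cos_sq_mul_exp :
    Tendsto (fun b : ℝ => b ^ 3 * ∫ x in (-π)..π,
      sin x ^ 2 * cos x ^ 2 * exp (-b ^ 2 * sin x ^ 2)) atTop (nhds √π) := by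
  have h := tendsto_integral_sin_sq_half_period.const_mul 2
  rw [mul_div_cancel₀ _ (two_ne_zero' ℝ)] at h
  refine h.congr fun b => ?_
  rw [integral_neg_pi_pi_eq_two_mul (fun x => by simp only [sin_add_pi, cos_add_pi, neg_sq])
    (by fun_prop)]
  ring

lemma integral_sum_sq_partials (ε t x₂ : ℝ) (B : ℝ → ℝ → ℝ → Fin 3 → ℝ)
    (hB : ∀ x₁ x₂ t : ℝ, B x₁ x₂ t =
      ![ε * sin x₂, 0, 1 + ε * cos x₁ * exp (-(ε ^ 2) * sin x₂ ^ 2 * t)]) :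
    ∫ x₁ in (-π)..π, ∑ j : Fin 3, ((deriv (fun y => B y x₂ t j) x₁) ^ 2 +
        (deriv (fun y => B x₁ y t j) x₂) ^ 2) =
      4 * π * ε ^ 6 * t ^ 2 *
          (sin x₂ ^ 2 * cos x₂ ^ 2 * exp (-(2 * ε ^ 2 * t) * sin x₂ ^ 2)) +
        (π * ε ^ 2 * exp (-(2 * ε ^ 2 * t) * sin x₂ ^ 2) + 2 * π * ε ^ 2 * cos x₂ ^ 2) := by
  have hexp : exp (-(ε ^ 2) * sin x₂ ^ 2 * t) ^ 2 = exp (-(2 * ε ^ 2 * t) * sin x₂ ^ 2) := by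
    rw [← exp_nat_mul]
    push_cast
    ring_nf
  have h₁ (x₁ : ℝ) : deriv (fun y => B y x₂ t 2) x₁ =
      -(ε * sin x₁ * exp (-(ε ^ 2) * sin x₂ ^ 2 * t)) := by
    simp only [hB]
    refine HasDerivAt.deriv ?_
    convert! (((hasDerivAt_cos x₁).const_mul ε).mul_const
      (exp (-(ε ^ 2) * sin x₂ ^ 2 * t))).const_add 1 using 1
    ring
  have h₂ (x₁ : ℝ) : deriv (fun y => B x₁ y t 2) x₂ =
      -(2 * ε ^ 3 * t * sin x₂ * cos x₂ * cos x₁ * exp (-(ε ^ 2) * sin x₂ ^ 2 * t)) := by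
    simp only [hB]
    refine HasDerivAt.deriv ?_
    convert! (((((hasDerivAt_sin x₂).pow 2).const_mul (-(ε ^ 2))).mul_const t).exp.const_mul
      (ε * cos x₁)).const_add 1 using 1
    rw [Pi.pow_apply]
    push_cast
    ring
  have h₃ (x₁ : ℝ) : deriv (fun y => B x₁ y t 0) x₂ = ε * cos x₂ := by
    simp only [hB]
    exact ((hasDerivAt_sin x₂).const_mul ε).deriv
  have h (x₁ : ℝ) : ∑ j : Fin 3, ((deriv (fun y => B y x₂ t j) x₁) ^ 2 +
      (deriv (fun y => B x₁ y t j) x₂) ^ 2) =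
      (ε ^ 2 * exp (-(2 * ε ^ 2 * t) * sin x₂ ^ 2)) * sin x₁ ^ 2 +
      (4 * ε ^ 6 * t ^ 2 * (sin x₂ ^ 2 * cos x₂ ^ 2 * exp (-(2 * ε ^ 2 * t) * sin x₂ ^ 2))) *
        cos x₁ ^ 2 + ε ^ 2 * cos x₂ ^ 2 := by
    rw [Fin.sum_univ_three, h₁, h₂, h₃, ← hexp]
    simp [hB]
    ring
  simp only [h]
  rw [intervalIntegral.integral_add (Continuous.intervalIntegrable (by fun_prop) _ _)
      (Continuous.intervalIntegrable (by fun_prop) _ _),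
    intervalIntegral.integral_add (Continuous.intervalIntegrable (by fun_prop) _ _)
      (Continuous.intervalIntegrable (by fun_prop) _ _),
    intervalIntegral.integral_const_mul, intervalIntegral.integral_const_mul,
    integral_sin_sq, integral_cos_sq, intervalIntegral.integral_const]
  simp only [sin_pi, sin_neg, cos_neg, cos_pi, smul_eq_mul]
  ring

lemma integral_exp_neg_mul_sin_sq_mem_Icc {a : ℝ} (ha : 0 ≤ a) :
    ∫ x in (-π)..π, exp (-a * sin x ^ 2) ∈ Set.Icc 0 (2 * π) := by
  have hπ : -π ≤ π := by linarith [pi_pos]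
  refine ⟨intervalIntegral.integral_nonneg hπ fun x _ => (exp_pos _).le, ?_⟩
  calc ∫ x in (-π)..π, exp (-a * sin x ^ 2) ≤ ∫ _ in (-π)..π, (1 : ℝ) := by
        refine intervalIntegral.integral_mono_on hπ
          (Continuous.intervalIntegrable (by fun_prop) _ _) (by simp) fun x _ => ?_
        rw [exp_le_one_iff]
        have := mul_nonneg ha (sq_nonneg (sin x))
        linarith
    _ = 2 * π := by simp; ring

lemma tendsto_main_term {ε : ℝ} (hε : 0 < ε) :
    Tendsto (fun t : ℝ => (4 * π * ε ^ 6 * t ^ 2 * ∫ x in (-π)..π,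
        sin x ^ 2 * cos x ^ 2 * exp (-(2 * ε ^ 2 * t) * sin x ^ 2)) / √t)
      atTop (nhds (√2 * π * √π * ε ^ 3)) := by
  have hb : Tendsto (fun t : ℝ => √2 * ε * √t) atTop atTop :=
    tendsto_sqrt_atTop.const_mul_atTop (by positivity)
  have h := (tendsto_integral_sin_sq_mul_cos_sq_mul_exp.comp hb).const_mul (√2 * π * ε ^ 3)
  rw [show √2 * π * ε ^ 3 * √π = √2 * π * √π * ε ^ 3 by ring] at h
  refine h.congr' ?_
  filter_upwards [eventually_gt_atTop 0] with t ht
  have h2 : √2 ^ 2 = 2 := sq_sqrt (by norm_num)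
  have hst : √t ^ 2 = t := sq_sqrt ht.le
  have hpos : 0 < √t := sqrt_pos.2 ht
  have hsq : (√2 * ε * √t) ^ 2 = 2 * ε ^ 2 * t := by
    rw [mul_pow, mul_pow, h2, hst]
  simp only [Function.comp_apply, hsq]
  rw [eq_div_iff hpos.ne']
  have hcoef : √2 * π * ε ^ 3 * (√2 * ε * √t) ^ 3 * √t = 4 * π * ε ^ 6 * t ^ 2 := by
    calc _ = π * ε ^ 6 * (√2 ^ 2) ^ 2 * (√t ^ 2) ^ 2 := by ring
      _ = _ := by rw [h2, hst]; ring
  rw [← hcoef]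
  ring

lemma tendsto_lower_order_term (ε : ℝ) :
    Tendsto (fun t : ℝ => (π * ε ^ 2 * (∫ x in (-π)..π, exp (-(2 * ε ^ 2 * t) * sin x ^ 2)) +
      2 * π * ε ^ 2 * π) / √t) atTop (nhds 0) := by
  refine squeeze_zero' (g := fun t => (π * ε ^ 2 * (2 * π) + 2 * π * ε ^ 2 * π) / √t)
    ?_ ?_ (tendsto_const_nhds.div_atTop tendsto_sqrt_atTop)
  all_goals
    filter_upwards [eventually_ge_atTop 0] with t ht
    obtain ⟨h₀, h₁⟩ := integral_exp_neg_mul_sin_sq_mem_Icc (show 0 ≤ 2 * ε ^ 2 * t by positivity)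
  · positivity
  · gcongr

lemma rpow_half_div_eq {ε t I : ℝ} (hε : 0 < ε) (ht : 0 < t) (hI : 0 ≤ I) :
    I ^ ((1 : ℝ) / 2) / ((2 * π ^ 3) ^ ((1 : ℝ) / 4) * ε ^ ((3 : ℝ) / 2) * t ^ ((1 : ℝ) / 4)) =
      (I / √t / (√2 * π * √π * ε ^ 3)) ^ ((1 : ℝ) / 2) := by
  have hsqrt : √(2 * π ^ 3) = √2 * π * √π := by
    rw [show 2 * π ^ 3 = 2 * π * π ^ 2 by ring, sqrt_mul (by positivity), sqrt_sq pi_pos.le,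
      sqrt_mul (by positivity)]
    ring
  have hquarter {x : ℝ} (hx : 0 ≤ x) : x ^ ((1 : ℝ) / 4) = √x ^ ((1 : ℝ) / 2) := by
    rw [sqrt_eq_rpow, ← rpow_mul hx]
    norm_num
  have hε3 : ε ^ ((3 : ℝ) / 2) = (ε ^ 3) ^ ((1 : ℝ) / 2) := by
    rw [← rpow_natCast, ← rpow_mul hε.le]
    norm_num
  rw [hquarter (by positivity), hquarter ht.le, hε3, hsqrt, ← mul_rpow (by positivity)
    (by positivity), ← mul_rpow (by positivity) (by positivity), ← div_rpow hI (by positivity),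
    div_div, mul_comm (√t)]

/-- For `ε ∈ (0,1]` and `B(x₁,x₂,t) = (ε sin x₂, 0, 1 + ε cos x₁ exp(−ε² sin²x₂ t))`,
the spatial-gradient `L²` norm of `B(·,t)` over `[−π,π]²` divided by
`(2π³)^{1/4} ε^{3/2} t^{1/4}` tends to `1` as `t → ∞`, even though `B` is uniformly
bounded for `t ≥ 0`. -/
theorem stmt_2 (ε : ℝ) (hε : ε ∈ Set.Ioc (0 : ℝ) 1)
    (B : ℝ → ℝ → ℝ → Fin 3 → ℝ)
    (hB : ∀ x₁ x₂ t : ℝ, B x₁ x₂ t =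
      ![ε * Real.sin x₂, 0,
        1 + ε * Real.cos x₁ * Real.exp (-(ε ^ 2) * Real.sin x₂ ^ 2 * t)]) :
    Tendsto (fun t : ℝ =>
      (∫ x₂ in (-π)..π, ∫ x₁ in (-π)..π,
          ∑ j : Fin 3,
            ((deriv (fun y => B y x₂ t j) x₁) ^ 2 +
              (deriv (fun y => B x₁ y t j) x₂) ^ 2)) ^ ((1 : ℝ) / 2) /
        ((2 * π ^ 3) ^ ((1 : ℝ) / 4) * ε ^ ((3 : ℝ) / 2) * t ^ ((1 : ℝ) / 4)))
      atTop (nhds 1) ∧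
    ∃ M : ℝ, ∀ x₁ x₂ : ℝ, ∀ t : ℝ, 0 ≤ t → ∀ j : Fin 3, |B x₁ x₂ t j| ≤ M := by
  obtain ⟨hε₀, -⟩ := hε
  constructor
  · have hlim := (((tendsto_main_term hε₀).add (tendsto_lower_order_term ε)).div_const
      (√2 * π * √π * ε ^ 3)).rpow_const (p := (1 : ℝ) / 2) (Or.inr (by norm_num))
    rw [add_zero, div_self (by positivity), one_rpow] at hlim
    refine hlim.congr' ?_
    filter_upwards [eventually_gt_atTop 0] with t ht
    have hint : ∫ x₂ in (-π)..π, ∫ x₁ in (-π)..π, ∑ j : Fin 3,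
        ((deriv (fun y => B y x₂ t j) x₁) ^ 2 + (deriv (fun y => B x₁ y t j) x₂) ^ 2) =
        4 * π * ε ^ 6 * t ^ 2 * (∫ x in (-π)..π,
          sin x ^ 2 * cos x ^ 2 * exp (-(2 * ε ^ 2 * t) * sin x ^ 2)) +
        (π * ε ^ 2 * (∫ x in (-π)..π, exp (-(2 * ε ^ 2 * t) * sin x ^ 2)) +
          2 * π * ε ^ 2 * π) := by
      simp only [integral_sum_sq_partials ε t _ B hB]
      rw [intervalIntegral.integral_add (Continuous.intervalIntegrable (by fun_prop) _ _)
          (Continuous.intervalIntegrable (by fun_prop) _ _),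
        intervalIntegral.integral_add (Continuous.intervalIntegrable (by fun_prop) _ _)
          (Continuous.intervalIntegrable (by fun_prop) _ _)]
      simp only [intervalIntegral.integral_const_mul, integral_cos_sq, sin_pi, sin_neg]
      ring
    have hpos : -π ≤ π := by linarith [pi_pos]
    rw [rpow_half_div_eq hε₀ ht (intervalIntegral.integral_nonneg hpos fun x₂ _ =>
      intervalIntegral.integral_nonneg hpos fun x₁ _ => by positivity), hint, ← add_div]
  · refine ⟨1 + ε, fun x₁ x₂ t ht j => ?_⟩
    have hE : exp (-(ε ^ 2) * sin x₂ ^ 2 * t) ≤ 1 := by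
      rw [exp_le_one_iff, neg_mul, neg_mul, neg_nonpos]
      positivity
    rw [hB]
    fin_cases j
    · have : ε * |sin x₂| ≤ ε := mul_le_of_le_one_right hε₀.le (abs_sin_le_one _)
      simp [abs_mul, abs_of_pos hε₀]
      linarith
    · simp
      linarith
    · refine (abs_add_le _ _).trans ?_
      rw [abs_one, abs_mul, abs_mul, abs_of_pos hε₀, abs_of_pos (exp_pos _)]
      gcongr
      exact (mul_le_of_le_one_right (by positivity) hE).trans
        (mul_le_of_le_one_right hε₀.le (abs_cos_le_one _))
end

section
/- Let b, v : ℝ² × [0,∞) → ℝ² and p : ℝ² × [0,∞) → ℝ be smooth (C^∞) and 2π-periodic in each spatial variable, with div b = div v = 0, v = (b·∇)b + ∇p, ∂_t b + (u·∇)b = (b·∇)u + ∂₁u where u := ∂₁b + v, and P₀b(·,0) = 0. Set a(x₂,t) := P₀b₁, f := b − P₀b, w := v − P₀v. Let p_L, p_N : ℝ² × [0,∞) → ℝ be smooth, 2π-periodic in each spatial variable, with zero average over [−π,π]² at each time, satisfying −Δp_L = 2 ∂₂a ∂₁f₂ and −Δp_N = 2((∂₁f₁)² + ∂₁f₂ ∂₂f₁).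 Then f satisfies ∂_t f = L(f) + N(f,w), where L(f) := (1+a)² ∂₁²f + (1+a) ∇∂₁p_L − (∂₂a ∂₂p_L) e₁, and N(f,w) := a ∂₁ P_⊥(f·∇f + ∇p_N) + P_⊥(f·∇w − w·∇f) − ∂₂P₀(f₁f₂) ∂₁f + 2 P_⊥(f·∇∂₁f) + ∇∂₁ P_⊥ p_N + ( ∂₂²P₀(f₁f₂) f₂ − ∂₂a P_⊥(f·∇f₂ + ∂₂p_N) ) e₁. -/
open Real Filter MeasureTheory

/-- Average in the first variable over one period. -/
noncomputable def P0 (ψ : ℝ → ℝ → ℝ) (x₂ : ℝ) : ℝ :=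
  (1 / (2 * Real.pi)) * ∫ x₁ in (-Real.pi)..Real.pi, ψ x₁ x₂

/-- Projection onto the part with vanishing `x₁`-average. -/
noncomputable def Pperp (ψ : ℝ → ℝ → ℝ) (x₁ x₂ : ℝ) : ℝ := ψ x₁ x₂ - P0 ψ x₂

open scoped ContDiff

/-- Derivative in the first variable. -/
noncomputable def partialFst (ψ : ℝ → ℝ → ℝ) (x y : ℝ) : ℝ := deriv (fun z => ψ z y) x

/-- Derivative in the second variable. -/
noncomputable def partialSnd (ψ : ℝ → ℝ → ℝ) (x y : ℝ) : ℝ := deriv (fun z => ψ x z) y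

lemma hasDerivAt_comp_of_differentiable {E : Type*} [NormedAddCommGroup E] [NormedSpace ℝ E]
    {g : E → ℝ} (hg : Differentiable ℝ g) {c : ℝ → E} {v : E} {s : ℝ} (hc : HasDerivAt c v s) :
    HasDerivAt (fun z => g (c z)) (fderiv ℝ g (c s) v) s :=
  (hg (c s)).hasFDerivAt.comp_hasDerivAt s hc

lemma contDiff_fderiv_apply_const {E : Type*} [NormedAddCommGroup E] [NormedSpace ℝ E]
    {g : E → ℝ} (hg : ContDiff ℝ ∞ g) (v : E) : ContDiff ℝ ∞ (fun q => fderiv ℝ g q v) :=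
  (hg.fderiv_right (m := ∞) (by simp)).clm_apply contDiff_const

section Partials

variable {ψ : ℝ → ℝ → ℝ} (hψ : ContDiff ℝ ∞ (Function.uncurry ψ))
include hψ

lemma hasDerivAt_fst (x y : ℝ) :
    HasDerivAt (fun z => ψ z y) (fderiv ℝ (Function.uncurry ψ) (x, y) (1, 0)) x :=
  hasDerivAt_comp_of_differentiable (g := Function.uncurry ψ) (c := fun z => (z, y))
    (hψ.differentiable (by simp)) ((hasDerivAt_id x).prodMk (hasDerivAt_const x y))

lemma hasDerivAt_snd (x y : ℝ) :
    HasDerivAt (fun z => ψ x z) (fderiv ℝ (Function.uncurry ψ) (x, y) (0, 1)) y :=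
  hasDerivAt_comp_of_differentiable (g := Function.uncurry ψ) (c := fun z => (x, z))
    (hψ.differentiable (by simp)) ((hasDerivAt_const y x).prodMk (hasDerivAt_id y))

lemma uncurry_partialFst :
    Function.uncurry (partialFst ψ) = fun q => fderiv ℝ (Function.uncurry ψ) q (1, 0) :=
  funext fun q => (hasDerivAt_fst hψ q.1 q.2).deriv

lemma uncurry_partialSnd :
    Function.uncurry (partialSnd ψ) = fun q => fderiv ℝ (Function.uncurry ψ) q (0, 1) :=
  funext fun q => (hasDerivAt_snd hψ q.1 q.2).deriv

lemma contDiff_partialFst : ContDiff ℝ ∞ (Function.uncurry (partialFst ψ)) := by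
  rw [uncurry_partialFst hψ]
  exact contDiff_fderiv_apply_const hψ _

lemma contDiff_partialSnd : ContDiff ℝ ∞ (Function.uncurry (partialSnd ψ)) := by
  rw [uncurry_partialSnd hψ]
  exact contDiff_fderiv_apply_const hψ _

lemma partialFst_partialSnd_comm :
    partialFst (partialSnd ψ) = partialSnd (partialFst ψ) := by
  have hd : ∀ q, DifferentiableAt ℝ (fderiv ℝ (Function.uncurry ψ)) q := fun q =>
    (hψ.fderiv_right (m := ∞) (by simp)).differentiable (by simp) q
  have hs : ∀ q, IsSymmSndFDerivAt ℝ (Function.uncurry ψ) q := fun q =>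
    hψ.contDiffAt.isSymmSndFDerivAt (by simpa using WithTop.coe_le_coe.2 (le_top (a := (2 : ℕ∞))))
  funext x y
  have h₁ := (hasDerivAt_fst (contDiff_partialSnd hψ) x y).deriv
  have h₂ := (hasDerivAt_snd (contDiff_partialFst hψ) x y).deriv
  rw [uncurry_partialSnd hψ, fderiv_clm_apply (hd _) (by fun_prop)] at h₁
  rw [uncurry_partialFst hψ, fderiv_clm_apply (hd _) (by fun_prop)] at h₂
  simp at h₁ h₂
  unfold partialFst partialSnd at *
  rw [h₁, h₂]
  exact hs (x, y) _ _

lemma intervalIntegrable_fst (y a b : ℝ) : IntervalIntegrable (fun x => ψ x y) volume a b :=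
  (hψ.continuous.comp (by fun_prop : Continuous fun x : ℝ => (x, y))).intervalIntegrable _ _

/-- Differentiation under the integral sign for smooth integrands. -/
lemma hasDerivAt_integral_of_smooth (a b y : ℝ) :
    HasDerivAt (fun y => ∫ x in a..b, ψ x y) (∫ x in a..b, partialSnd ψ x y) y := by
  have hc := (contDiff_partialSnd hψ).continuous
  obtain ⟨C, hC⟩ := (isCompact_uIcc.prod (isCompact_closedBall y 1) :
    IsCompact (Set.uIcc a b ×ˢ Metric.closedBall y 1)).exists_bound_of_continuousOn hc.continuousOn
  refine (intervalIntegral.hasDerivAt_integral_of_dominated_loc_of_deriv_le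
    (F := fun y x => ψ x y) (F' := fun y x => partialSnd ψ x y) (bound := fun _ => C)
    (Metric.ball_mem_nhds y one_pos) ?_ (intervalIntegrable_fst hψ y a b) ?_ ?_ (by simp) ?_).2
  · exact Filter.Eventually.of_forall fun z =>
      (hψ.continuous.comp (by fun_prop : Continuous fun x : ℝ => (x, z))).aestronglyMeasurable
  · exact (hc.comp (by fun_prop : Continuous fun x : ℝ => (x, y))).aestronglyMeasurable
  · exact Filter.Eventually.of_forall fun x hx z hz =>
      hC (x, z) ⟨Set.uIoc_subset_uIcc hx, Metric.ball_subset_closedBall hz⟩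
  · exact Filter.Eventually.of_forall fun x _ z _ =>
      (hasDerivAt_snd hψ x z).differentiableAt.hasDerivAt

lemma hasDerivAt_P0 (y : ℝ) : HasDerivAt (P0 ψ) (P0 (partialSnd ψ) y) y :=
  (hasDerivAt_integral_of_smooth hψ _ _ y).const_mul _

end Partials

lemma contDiff_P0 {ψ : ℝ → ℝ → ℝ} (hψ : ContDiff ℝ ∞ (Function.uncurry ψ)) :
    ContDiff ℝ ∞ (P0 ψ) := by
  rw [contDiff_infty]
  intro n
  induction n generalizing ψ with
  | zero =>
    exact contDiff_zero.2 (continuous_iff_continuousAt.2 fun y => (hasDerivAt_P0 hψ y).continuousAt)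
  | succ n ih =>
    push_cast
    rw [contDiff_succ_iff_deriv]
    refine ⟨fun y => (hasDerivAt_P0 hψ y).differentiableAt, by simp, ?_⟩
    rw [show deriv (P0 ψ) = P0 (partialSnd ψ) from funext fun y => (hasDerivAt_P0 hψ y).deriv]
    exact ih (contDiff_partialSnd hψ)

/-- Smooth functions on the plane that are `2π`-periodic in each variable. -/
def TorusFun : Subalgebra ℝ (ℝ → ℝ → ℝ) where
  carrier := {ψ | ContDiff ℝ ∞ (Function.uncurry ψ) ∧
    ∀ x y, ψ (x + 2 * π) y = ψ x y ∧ ψ x (y + 2 * π) = ψ x y}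
  mul_mem' := fun {a b} ha hb => ⟨ha.1.mul hb.1, fun x y => by
    simp [(ha.2 x y).1, (ha.2 x y).2, (hb.2 x y).1, (hb.2 x y).2]⟩
  add_mem' := fun {a b} ha hb => ⟨ha.1.add hb.1, fun x y => by
    simp [(ha.2 x y).1, (ha.2 x y).2, (hb.2 x y).1, (hb.2 x y).2]⟩
  algebraMap_mem' := fun r => ⟨contDiff_const (c := r), fun x y => ⟨rfl, rfl⟩⟩

namespace TorusFun

lemma smooth (ψ : TorusFun) : ContDiff ℝ ∞ (Function.uncurry ψ.1) := ψ.2.1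

@[ext] lemma ext {φ ψ : TorusFun} (h : ∀ x y, φ.1 x y = ψ.1 x y) : φ = ψ :=
  Subtype.ext (funext fun x => funext fun y => h x y)

/-- The derivation `∂₁`. -/
noncomputable def dx : Derivation ℝ TorusFun TorusFun :=
  Derivation.mk'
    { toFun := fun ψ => ⟨partialFst ψ.1, contDiff_partialFst (smooth ψ), fun x y => by
        constructor
        · unfold partialFst
          rw [← deriv_comp_add_const (fun z => ψ.1 z y)]
          congr 1
          funext z
          exact (ψ.2.2 z y).1
        · exact congrArg (fun g => deriv g x) (funext fun z => (ψ.2.2 z y).2)⟩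
      map_add' := fun φ ψ => by
        ext x y
        exact deriv_add (hasDerivAt_fst (smooth φ) x y).differentiableAt
          (hasDerivAt_fst (smooth ψ) x y).differentiableAt
      map_smul' := fun r ψ => by
        ext x y
        exact deriv_const_mul r (hasDerivAt_fst (smooth ψ) x y).differentiableAt }
    fun φ ψ => by
      ext x y
      refine (deriv_mul (hasDerivAt_fst (smooth φ) x y).differentiableAt
        (hasDerivAt_fst (smooth ψ) x y).differentiableAt).trans ?_
      change _ = φ.1 x y * deriv (fun z => ψ.1 z y) x + ψ.1 x y * deriv (fun z => φ.1 z y) x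
      ring

/-- The derivation `∂₂`. -/
noncomputable def dy : Derivation ℝ TorusFun TorusFun :=
  Derivation.mk'
    { toFun := fun ψ => ⟨partialSnd ψ.1, contDiff_partialSnd (smooth ψ), fun x y => by
        constructor
        · exact congrArg (fun g => deriv g y) (funext fun z => (ψ.2.2 x z).1)
        · unfold partialSnd
          rw [← deriv_comp_add_const (fun z => ψ.1 x z)]
          congr 1
          funext z
          exact (ψ.2.2 x z).2⟩
      map_add' := fun φ ψ => by
        ext x y
        exact deriv_add (hasDerivAt_snd (smooth φ) x y).differentiableAt
          (hasDerivAt_snd (smooth ψ) x y).differentiableAt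
      map_smul' := fun r ψ => by
        ext x y
        exact deriv_const_mul r (hasDerivAt_snd (smooth ψ) x y).differentiableAt }
    fun φ ψ => by
      ext x y
      refine (deriv_mul (hasDerivAt_snd (smooth φ) x y).differentiableAt
        (hasDerivAt_snd (smooth ψ) x y).differentiableAt).trans ?_
      change _ = φ.1 x y * deriv (fun z => ψ.1 x z) y + ψ.1 x y * deriv (fun z => φ.1 x z) y
      ring

/-- The average in the first variable. -/
noncomputable def avg : TorusFun →ₗ[ℝ] TorusFun where
  toFun := fun ψ => ⟨fun _ y => P0 ψ.1 y, (contDiff_P0 (smooth ψ)).comp contDiff_snd, fun x y =>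
    ⟨rfl, congrArg (fun g : ℝ → ℝ => (1 / (2 * π)) * ∫ z in (-π)..π, g z)
      (funext fun z => (ψ.2.2 z y).2)⟩⟩
  map_add' := fun φ ψ => by
    ext x y
    change (1 / (2 * π)) * ∫ z in (-π)..π, (φ.1 z y + ψ.1 z y) = _
    rw [intervalIntegral.integral_add (intervalIntegrable_fst (smooth φ) _ _ _)
      (intervalIntegrable_fst (smooth ψ) _ _ _), mul_add]
    rfl
  map_smul' := fun r ψ => by
    ext x y
    change (1 / (2 * π)) * ∫ z in (-π)..π, (r * ψ.1 z y) = r * ((1 / (2 * π)) * _)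
    rw [intervalIntegral.integral_const_mul]
    ring

lemma dx_mul (φ ψ : TorusFun) : dx (φ * ψ) = φ * dx ψ + ψ * dx φ := dx.leibniz φ ψ

lemma dy_mul (φ ψ : TorusFun) : dy (φ * ψ) = φ * dy ψ + ψ * dy φ := dy.leibniz φ ψ

lemma dx_dy (ψ : TorusFun) : dx (dy ψ) = dy (dx ψ) :=
  Subtype.ext (partialFst_partialSnd_comm (smooth ψ))

lemma dx_avg (ψ : TorusFun) : dx (avg ψ) = 0 := by
  ext x y
  exact deriv_const x ((avg ψ).1 x y)

lemma avg_dy (ψ : TorusFun) : avg (dy ψ) = dy (avg ψ) := by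
  ext x y
  exact (hasDerivAt_P0 (smooth ψ) y).deriv.symm

lemma avg_dx (ψ : TorusFun) : avg (dx ψ) = 0 := by
  ext x y
  change (1 / (2 * π)) * ∫ z in (-π)..π, deriv (fun z => ψ.1 z y) z = 0
  rw [intervalIntegral.integral_deriv_eq_sub
    (fun z _ => (hasDerivAt_fst (smooth ψ) z y).differentiableAt)
    (intervalIntegrable_fst (smooth (dx ψ)) y _ _)]
  have := (ψ.2.2 (-π) y).1
  rw [show -π + 2 * π = π by ring] at this
  simp [this]

lemma avg_avg_mul (φ ψ : TorusFun) : avg (avg φ * ψ) = avg φ * avg ψ := by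
  ext x y
  change (1 / (2 * π)) * ∫ z in (-π)..π, (P0 φ.1 y * ψ.1 z y)
    = P0 φ.1 y * ((1 / (2 * π)) * ∫ z in (-π)..π, ψ.1 z y)
  rw [intervalIntegral.integral_const_mul]
  ring

lemma avg_avg (ψ : TorusFun) : avg (avg ψ) = avg ψ := by
  ext x y
  change (1 / (2 * π)) * ∫ z in (-π)..π, P0 ψ.1 y = P0 ψ.1 y
  rw [intervalIntegral.integral_const]
  have := Real.pi_pos
  simp only [smul_eq_mul]
  field_simp
  ring

/-- A continuous nonnegative periodic function with vanishing integral over a period is zero. -/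
lemma _root_.Function.Periodic.eq_zero_of_integral_eq_zero {g : ℝ → ℝ}
    (hper : Function.Periodic g (2 * π)) (hc : Continuous g) (h0 : ∀ x, 0 ≤ g x)
    (hi : ∫ x in (-π)..π, g x = 0) (x : ℝ) : g x = 0 := by
  by_contra hx
  have hpos : 0 < ∫ z in x..(x + 2 * π), g z :=
    intervalIntegral.integral_pos (by linarith [Real.pi_pos]) hc.continuousOn (fun z _ => h0 z)
      ⟨x, ⟨le_rfl, by linarith [Real.pi_pos]⟩, lt_of_le_of_ne (h0 x) (Ne.symm hx)⟩
  rw [hper.intervalIntegral_add_eq x (-π), show -π + 2 * π = π by ring, hi] at hpos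
  exact lt_irrefl _ hpos

lemma eq_zero_of_avg_eq_zero {ψ : TorusFun} (h0 : ∀ x y, 0 ≤ ψ.1 x y) (h : avg ψ = 0) : ψ = 0 := by
  ext x y
  refine Function.Periodic.eq_zero_of_integral_eq_zero (g := fun x => ψ.1 x y)
    (fun x => (ψ.2.2 x y).1) ((smooth ψ).continuous.comp
      (by fun_prop : Continuous fun x : ℝ => (x, y))) (fun x => h0 x y) ?_ x
  have h1 : (1 / (2 * π)) * ∫ z in (-π)..π, ψ.1 z y = 0 :=
    congrFun (congrFun (congrArg Subtype.val h) 0) y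
  exact (mul_eq_zero.1 h1).resolve_left (by positivity)

/-- A nonnegative torus function whose `x`-average is a `y`-derivative vanishes. -/
lemma eq_zero_of_avg_eq_dy {ψ φ : TorusFun} (h0 : ∀ x y, 0 ≤ ψ.1 x y) (h : avg ψ = dy φ) :
    ψ = 0 := by
  apply eq_zero_of_avg_eq_zero h0
  ext x y
  refine Function.Periodic.eq_zero_of_integral_eq_zero (g := fun y => (avg ψ).1 x y)
    (fun y => ((avg ψ).2.2 x y).2) ((smooth (avg ψ)).continuous.comp
      (by fun_prop : Continuous fun y : ℝ => (x, y))) (fun y => ?_) ?_ y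
  · exact mul_nonneg (by positivity) (intervalIntegral.integral_nonneg
      (by linarith [Real.pi_pos]) fun z _ => h0 z y)
  · rw [h]
    change ∫ z in (-π)..π, deriv (fun z => φ.1 x z) z = 0
    rw [intervalIntegral.integral_deriv_eq_sub
      (fun z _ => (hasDerivAt_snd (smooth φ) x z).differentiableAt)
      (((smooth (dy φ)).continuous.comp
        (by fun_prop : Continuous fun z : ℝ => (x, z))).intervalIntegrable _ _)]
    have := (φ.2.2 x (-π)).2
    rw [show -π + 2 * π = π by ring] at this
    simp [this]

/-- Harmonic functions on the torus have zero gradient. -/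
lemma gradient_eq_zero_of_harmonic {q : TorusFun} (h : dx (dx q) + dy (dy q) = 0) :
    dx q = 0 ∧ dy q = 0 := by
  have hsq : dx q * dx q + dy q * dy q = 0 := by
    apply eq_zero_of_avg_eq_dy (φ := avg (q * dy q))
    · intro x y
      exact add_nonneg (mul_self_nonneg ((dx q).1 x y)) (mul_self_nonneg ((dy q).1 x y))
    · have : dx q * dx q + dy q * dy q = dx (q * dx q) + dy (q * dy q) := by
        rw [dx_mul, dy_mul]
        linear_combination (-q) * h
      rw [this, map_add, avg_dx, avg_dy, zero_add]
  have key : ∀ x y, (dx q).1 x y * (dx q).1 x y + (dy q).1 x y * (dy q).1 x y = 0 := fun x y =>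
    congrFun (congrFun (congrArg Subtype.val hsq) x) y
  constructor
  · ext x y
    have := key x y
    change (dx q).1 x y = 0
    nlinarith [mul_self_nonneg ((dx q).1 x y), mul_self_nonneg ((dy q).1 x y)]
  · ext x y
    have := key x y
    change (dy q).1 x y = 0
    nlinarith [mul_self_nonneg ((dx q).1 x y), mul_self_nonneg ((dy q).1 x y)]

/-- The projection onto functions with vanishing `x`-average. -/
noncomputable def perp (ψ : TorusFun) : TorusFun := ψ - avg ψ

lemma perp_add (φ ψ : TorusFun) : perp (φ + ψ) = perp φ + perp ψ := by
  simp only [perp, map_add]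
  ring

lemma perp_sub (φ ψ : TorusFun) : perp (φ - ψ) = perp φ - perp ψ := by
  simp only [perp, map_sub]
  ring

lemma avg_perp (ψ : TorusFun) : avg (perp ψ) = 0 := by
  simp [perp, avg_avg]

lemma perp_of_avg_eq_zero {ψ : TorusFun} (h : avg ψ = 0) : perp ψ = ψ := by
  simp [perp, h]

lemma dx_perp (ψ : TorusFun) : dx (perp ψ) = dx ψ := by
  simp [perp, dx_avg]

lemma dx_of_avg_eq {c : TorusFun} (h : avg c = c) : dx c = 0 := by
  rw [← h, dx_avg]

lemma dy_of_avg_eq {c : TorusFun} (h : avg c = c) : avg (dy c) = dy c := by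
  rw [avg_dy, h]

lemma avg_mul_of_avg_eq {c : TorusFun} (h : avg c = c) (ψ : TorusFun) :
    avg (c * ψ) = c * avg ψ := by
  conv_lhs => rw [← h]
  rw [avg_avg_mul, h]

/-- The projected evolution of one component `g + c` of the magnetic field. -/
lemma perp_evolution {f₁ f₂ w₁ w₂ a V g h c U q r B : TorusFun}
    (hf₂ : avg f₂ = 0) (hw₂ : avg w₂ = 0) (ha : avg a = a) (hV : avg V = V)
    (hc : avg c = c) (hU : avg U = U)
    (hB : B + (dx f₁ + w₁ + V) * dx (g + c) + (dx f₂ + w₂) * dy (g + c)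
      = (f₁ + a) * dx (dx g + h + U) + f₂ * dy (dx g + h + U) + dx (dx g + h + U))
    (hh : h = perp (f₁ * dx g + f₂ * dy g + q) + a * dx g + f₂ * dy c + perp r) :
    perp B = ((1 + a) ^ 2 * dx (dx g) + (1 + a) * dx r)
      + (a * dx (perp (f₁ * dx g + f₂ * dy g + q))
        + perp (f₁ * dx h + f₂ * dy h - (w₁ * dx g + w₂ * dy g))
        - V * dx g
        + 2 * perp (f₁ * dx (dx g) + f₂ * dy (dx g))
        + dx q + f₂ * dy U + dy c * (a * dx f₂ - w₂)) := by
  have hca := dx_of_avg_eq ha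
  have hcc := dx_of_avg_eq hc
  have hcU := dx_of_avg_eq hU
  have hdxyc : dx (dy c) = 0 := by rw [dx_dy, hcc, map_zero]
  set X := f₁ * dx (dx g) + f₂ * dy (dx g) with hX
  set S := dx f₁ * dx g + dx f₂ * dy g with hS
  set Y := f₁ * dx h + f₂ * dy h - (w₁ * dx g + w₂ * dy g) with hY
  set Z := (1 + a) * (dx (dx g) + dx h) + f₂ * dy U - dx f₂ * dy c - w₂ * dy c - V * dx g with hZ
  have hBX : B = X - S + Y + Z := by
    simp only [map_add, hcc, hcU] at hB
    rw [hX, hS, hY, hZ]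
    linear_combination hB
  have hZ0 : avg Z = 0 := by
    have e : Z = dx (dx g) + dx h + a * (dx (dx g) + dx h) + dy U * f₂ - dy c * dx f₂ - dy c * w₂
        - V * dx g := by rw [hZ]; ring
    rw [e]
    simp only [map_add, map_sub, avg_mul_of_avg_eq ha, avg_mul_of_avg_eq hV,
      avg_mul_of_avg_eq (dy_of_avg_eq hU), avg_mul_of_avg_eq (dy_of_avg_eq hc), avg_dx, hf₂, hw₂]
    ring
  have hpB : perp B = perp X - perp S + perp Y + Z := by
    rw [hBX, perp_add, perp_add, perp_sub, perp_of_avg_eq_zero hZ0]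
  have hXS : dx (f₁ * dx g + f₂ * dy g) = perp X + perp S := by
    rw [← perp_add, ← perp_of_avg_eq_zero (avg_dx _)]
    congr 1
    simp only [map_add, dx_mul, dx_dy, hX, hS]
    ring
  have hdh : dx h = perp X + perp S + dx q + a * dx (dx g) + dy c * dx f₂ + dx r := by
    conv_lhs => rw [hh]
    rw [map_add, map_add, map_add, dx_perp, dx_perp, map_add, hXS, dx_mul a, dx_mul f₂, hca, hdxyc]
    ring
  rw [hpB, dx_perp, map_add, hXS, hZ]
  linear_combination (1 + a) * hdh

/-- The velocity part transverse to the background field has zero `x`-average. -/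
lemma avg_velocity_snd {b₁ b₂ v₁ v₂ p : TorusFun} (hb : dx b₁ + dy b₂ = 0) (hv : dx v₁ + dy v₂ = 0)
    (hv₂ : v₂ = b₁ * dx b₂ + b₂ * dy b₂ + dy p) : avg v₂ = 0 := by
  have h₁ : v₂ = dx (b₁ * b₂) + dy (b₂ * b₂ + p) := by
    rw [hv₂, map_add, dx_mul, dy_mul]
    linear_combination (-b₂) * hb
  have h₂ : avg v₂ = dy (avg (b₂ * b₂ + p)) := by
    rw [h₁, map_add, avg_dx, avg_dy, zero_add]
  have h₃ : dy (avg v₂) = 0 := by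
    rw [← avg_dy, show dy v₂ = - dx v₁ by linear_combination hv, map_neg, avg_dx, neg_zero]
  rw [h₂] at h₃ ⊢
  exact (gradient_eq_zero_of_harmonic (by rw [h₃, dx_avg, map_zero, zero_add])).2

/-- The mean of the transverse field is conserved. -/
lemma avg_evolution_snd {b₁ b₂ u₁ u₂ B : TorusFun} (hb : dx b₁ + dy b₂ = 0) (hu : dx u₁ + dy u₂ = 0)
    (hB : B + u₁ * dx b₂ + u₂ * dy b₂ = b₁ * dx u₂ + b₂ * dy u₂ + dx u₂) : avg B = 0 := by
  have : B = dx (b₁ * u₂ - u₁ * b₂ + u₂) := by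
    simp only [map_add, map_sub, dx_mul]
    linear_combination hB - u₂ * hb + b₂ * hu
  rw [this, avg_dx]

/-- The pressure gradient is the sum of its linear and nonlinear parts. -/
lemma pressure_split {f₁ f₂ a v₁ v₂ p pL pN : TorusFun} (hdiv : dx f₁ + dy f₂ = 0) (hda : dx a = 0)
    (hv₁ : v₁ = (f₁ + a) * dx (f₁ + a) + f₂ * dy (f₁ + a) + dx p)
    (hv₂ : v₂ = (f₁ + a) * dx f₂ + f₂ * dy f₂ + dy p) (hv : dx v₁ + dy v₂ = 0)
    (hpL : -(dx (dx pL) + dy (dy pL)) = 2 * dy a * dx f₂)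
    (hpN : -(dx (dx pN) + dy (dy pN)) = 2 * (dx f₁ ^ 2 + dx f₂ * dy f₁)) :
    dx (p - pL - pN) = 0 ∧ dy (p - pL - pN) = 0 := by
  have hd12 : dx (dx f₁) + dy (dx f₂) = 0 := by
    rw [← dx_dy, ← map_add, hdiv, map_zero]
  have hd22 : dy (dx f₁) + dy (dy f₂) = 0 := by
    rw [← map_add, hdiv, map_zero]
  apply gradient_eq_zero_of_harmonic
  have hx : dx p = v₁ - ((f₁ + a) * dx (f₁ + a) + f₂ * dy (f₁ + a)) := by rw [hv₁]; ring
  have hy : dy p = v₂ - ((f₁ + a) * dx f₂ + f₂ * dy f₂) := by rw [hv₂]; ring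
  simp only [map_sub, hx, hy, map_add, dx_mul, dy_mul, hda, dx_dy, map_zero]
  linear_combination hv + hpL + hpN - (f₁ + a) * hd12 - f₂ * hd22
    - (dy f₂ - dx f₁) * hdiv

set_option maxHeartbeats 1000000 in
lemma projected_evolution {b₁ b₂ v₁ v₂ p pL pN B₁ B₂ a f₁ f₂ w₁ w₂ m : TorusFun}
    (hb : dx b₁ + dy b₂ = 0) (hv : dx v₁ + dy v₂ = 0)
    (hv₁ : v₁ = b₁ * dx b₁ + b₂ * dy b₁ + dx p)
    (hv₂ : v₂ = b₁ * dx b₂ + b₂ * dy b₂ + dy p)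
    (hB₁ : B₁ + (dx b₁ + v₁) * dx b₁ + (dx b₂ + v₂) * dy b₁
      = b₁ * dx (dx b₁ + v₁) + b₂ * dy (dx b₁ + v₁) + dx (dx b₁ + v₁))
    (hB₂ : B₂ + (dx b₁ + v₁) * dx b₂ + (dx b₂ + v₂) * dy b₂
      = b₁ * dx (dx b₂ + v₂) + b₂ * dy (dx b₂ + v₂) + dx (dx b₂ + v₂))
    (hb₂ : avg b₂ = 0) (ha : a = avg b₁) (hf₁ : f₁ = perp b₁) (hf₂ : f₂ = perp b₂)
    (hw₁ : w₁ = perp v₁) (hw₂ : w₂ = perp v₂) (hm : m = avg (f₁ * f₂))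
    (hpL : -(dx (dx pL) + dy (dy pL)) = 2 * dy a * dx f₂)
    (hpN : -(dx (dx pN) + dy (dy pN)) = 2 * (dx f₁ ^ 2 + dx f₂ * dy f₁)) :
    perp B₁ = ((1 + a) ^ 2 * dx (dx f₁) + (1 + a) * dx (dx pL) - dy a * dy pL)
      + (a * dx (perp (f₁ * dx f₁ + f₂ * dy f₁ + dx pN))
        + perp (f₁ * dx w₁ + f₂ * dy w₁ - (w₁ * dx f₁ + w₂ * dy f₁))
        - dy m * dx f₁
        + 2 * perp (f₁ * dx (dx f₁) + f₂ * dy (dx f₁))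
        + dx (dx (perp pN))
        + (dy (dy m) * f₂ - dy a * perp (f₁ * dx f₂ + f₂ * dy f₂ + dy pN))) ∧
    perp B₂ = ((1 + a) ^ 2 * dx (dx f₂) + (1 + a) * dy (dx pL))
      + (a * dx (perp (f₁ * dx f₂ + f₂ * dy f₂ + dy pN))
        + perp (f₁ * dx w₂ + f₂ * dy w₂ - (w₁ * dx f₂ + w₂ * dy f₂))
        - dy m * dx f₂
        + 2 * perp (f₁ * dx (dx f₂) + f₂ * dy (dx f₂))
        + dy (dx (perp pN))) := by
  have haa : avg a = a := by rw [ha, avg_avg]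
  have hda := dx_of_avg_eq haa
  have hmm : avg m = m := by rw [hm, avg_avg]
  have hb₁f : b₁ = f₁ + a := by rw [hf₁, ha, perp]; ring
  have hb₂f : b₂ = f₂ := by rw [hf₂, perp_of_avg_eq_zero hb₂]
  have hf₂0 : avg f₂ = 0 := by rw [hf₂, avg_perp]
  have hw₂0 : avg w₂ = 0 := by rw [hw₂, avg_perp]
  have hvw₂ : v₂ = w₂ := by rw [hw₂, perp_of_avg_eq_zero (avg_velocity_snd hb hv hv₂)]
  have hdiv : dx f₁ + dy f₂ = 0 := by
    rw [← hb, hb₁f, hb₂f, map_add, hda, add_zero]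
  have hgrad := pressure_split hdiv hda (by rw [← hb₁f, ← hb₂f]; exact hv₁)
    (by rw [← hb₁f, ← hb₂f]; exact hv₂) hv hpL hpN
  have hpx : dx p = dx pL + dx pN := by
    have := hgrad.1
    rw [map_sub, map_sub] at this
    linear_combination this
  have hpy : dy p = dy pL + dy pN := by
    have := hgrad.2
    rw [map_sub, map_sub] at this
    linear_combination this
  have hpL0 : dy (avg pL) = 0 := by
    refine (gradient_eq_zero_of_harmonic ?_).2
    rw [dx_avg, map_zero, zero_add, ← avg_dy, ← avg_dy,
      show dy (dy pL) = - dx (dx pL) - dy a * (2 * dx f₂) by linear_combination -hpL, map_sub,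
      map_neg, avg_dx, avg_mul_of_avg_eq (dy_of_avg_eq haa), two_mul, map_add, avg_dx]
    ring
  have hpLy : perp (dy pL) = dy pL := perp_of_avg_eq_zero (by rw [avg_dy, hpL0])
  have hadx : ∀ ψ, perp (a * dx ψ) = a * dx ψ := fun ψ =>
    perp_of_avg_eq_zero (by rw [avg_mul_of_avg_eq haa, avg_dx, mul_zero])
  have hf₂a : perp (f₂ * dy a) = f₂ * dy a := perp_of_avg_eq_zero (by
    rw [mul_comm, avg_mul_of_avg_eq (dy_of_avg_eq haa), hf₂0, mul_zero])
  have hw₁e : w₁ = perp (f₁ * dx f₁ + f₂ * dy f₁ + dx pN) + a * dx f₁ + f₂ * dy a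
      + perp (dx pL) := by
    rw [hw₁, ← hadx, ← hf₂a, ← perp_add, ← perp_add, ← perp_add, hv₁, hpx, hb₁f, hb₂f, map_add,
      map_add, hda]
    congr 1
    ring
  have hw₂e : w₂ = perp (f₁ * dx f₂ + f₂ * dy f₂ + dy pN) + a * dx f₂ + f₂ * dy 0
      + perp (dy pL) := by
    rw [hw₂, ← hadx, map_zero, mul_zero, add_zero, ← perp_add, ← perp_add, hv₂, hpy, hb₁f, hb₂f]
    congr 1
    ring
  have hvw₁ : v₁ = w₁ + dy m := by
    have : v₁ = dx (b₁ * b₁ + p) + dy (f₁ * f₂) + dy (a * f₂) := by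
      rw [hv₁, hb₁f, hb₂f]
      simp only [map_add, dx_mul, dy_mul, hda]
      linear_combination (-(f₁ + a)) * hdiv
    have : avg v₁ = dy m := by
      rw [this, map_add, map_add, avg_dx, avg_dy, avg_dy, avg_mul_of_avg_eq haa, hf₂0, mul_zero,
        map_zero, hm]
      ring
    rw [hw₁, perp, this]
    ring
  have hdm := dy_of_avg_eq hmm
  have h₁ := perp_evolution (B := B₁) (w₁ := w₁) (g := f₁) (h := w₁) (c := a) (U := dy m) (q := dx pN)
    (r := dx pL) hf₂0 hw₂0 haa hdm haa hdm (by
      rw [hvw₁, hvw₂, hb₁f, hb₂f] at hB₁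
      simp only [map_add, hda, map_zero] at hB₁ ⊢
      linear_combination hB₁) hw₁e
  have h₂ := perp_evolution (B := B₂) (w₁ := w₁) (g := f₂) (h := w₂) (c := 0) (U := 0) (q := dy pN)
    (r := dy pL) hf₂0 hw₂0 haa hdm (map_zero _) (map_zero _) (by
      rw [hvw₁, hvw₂, hb₁f, hb₂f] at hB₂
      simp only [map_add, hda, map_zero] at hB₂ ⊢
      linear_combination hB₂) hw₂e
  rw [hpLy, map_zero, mul_zero, add_zero] at hw₂e
  constructor
  · rw [h₁, dx_perp pN]
    linear_combination (-dy a) * hw₂e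
  · rw [h₂, dx_perp pN, map_zero, dx_dy, dx_dy]
    ring

end TorusFun

section Slices

variable {ψ : ℝ → ℝ → ℝ → ℝ} (hψ : ContDiff ℝ ∞ (fun q : ℝ × ℝ × ℝ => ψ q.1 q.2.1 q.2.2))

/-- The time slice of a smooth spatially periodic function. -/
def timeSlice (hψ : ContDiff ℝ ∞ (fun q : ℝ × ℝ × ℝ => ψ q.1 q.2.1 q.2.2))
    (hper : ∀ x₁ x₂ t : ℝ, ψ (x₁ + 2 * π) x₂ t = ψ x₁ x₂ t ∧ ψ x₁ (x₂ + 2 * π) t = ψ x₁ x₂ t)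
    (t : ℝ) : TorusFun :=
  ⟨fun x y => ψ x y t,
    hψ.comp (contDiff_fst.prodMk (contDiff_snd.prodMk contDiff_const) :
      ContDiff ℝ ∞ fun q : ℝ × ℝ => (q.1, q.2, t)), fun x y => hper x y t⟩

include hψ in
lemma hasDerivAt_time (x y t : ℝ) : HasDerivAt (fun s => ψ x y s)
    (fderiv ℝ (fun q : ℝ × ℝ × ℝ => ψ q.1 q.2.1 q.2.2) (x, y, t) (0, 0, 1)) t :=
  hasDerivAt_comp_of_differentiable (c := fun s => (x, y, s)) (hψ.differentiable (by simp))
    ((hasDerivAt_const t x).prodMk ((hasDerivAt_const t y).prodMk (hasDerivAt_id t)))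

/-- The time slice of the time derivative of a smooth spatially periodic function. -/
noncomputable def timeDerivSlice (hψ : ContDiff ℝ ∞ (fun q : ℝ × ℝ × ℝ => ψ q.1 q.2.1 q.2.2))
    (hper : ∀ x₁ x₂ t : ℝ, ψ (x₁ + 2 * π) x₂ t = ψ x₁ x₂ t ∧ ψ x₁ (x₂ + 2 * π) t = ψ x₁ x₂ t)
    (t : ℝ) : TorusFun :=
  ⟨fun x y => deriv (fun s => ψ x y s) t, by
    have : (Function.uncurry fun x y => deriv (fun s => ψ x y s) t) = fun q : ℝ × ℝ =>
        fderiv ℝ (fun q : ℝ × ℝ × ℝ => ψ q.1 q.2.1 q.2.2) (q.1, q.2, t) (0, 0, 1) :=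
      funext fun q => (hasDerivAt_time hψ q.1 q.2 t).deriv
    rw [this]
    exact (contDiff_fderiv_apply_const hψ _).comp
      (contDiff_fst.prodMk (contDiff_snd.prodMk contDiff_const) :
        ContDiff ℝ ∞ fun q : ℝ × ℝ => (q.1, q.2, t)),
    fun x y => ⟨congrArg (fun g => deriv g t) (funext fun s => (hper x y s).1),
      congrArg (fun g => deriv g t) (funext fun s => (hper x y s).2)⟩⟩

include hψ in
lemma hasDerivAt_P0_time (y t : ℝ) : HasDerivAt (fun s => P0 (fun x y => ψ x y s) y)
    (P0 (fun x y => deriv (fun s => ψ x y s) t) y) t :=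
  hasDerivAt_P0 (ψ := fun x s => ψ x y s)
    (hψ.comp (contDiff_fst.prodMk (contDiff_const.prodMk contDiff_snd) :
      ContDiff ℝ ∞ fun q : ℝ × ℝ => (q.1, y, q.2))) t

include hψ in
lemma deriv_Pperp_time (x y t : ℝ) : deriv (fun s => Pperp (fun x y => ψ x y s) x y) t
    = Pperp (fun x y => deriv (fun s => ψ x y s) t) x y :=
  ((hasDerivAt_time hψ x y t).differentiableAt.hasDerivAt.sub (hasDerivAt_P0_time hψ y t)).deriv

include hψ in
lemma P0_eq_zero_of_deriv_eq_zero (h0 : ∀ y, P0 (fun x y => ψ x y 0) y = 0)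
    (h : ∀ y t, 0 ≤ t → P0 (fun x y => deriv (fun s => ψ x y s) t) y = 0)
    {t : ℝ} (ht : 0 ≤ t) (y : ℝ) : P0 (fun x y => ψ x y t) y = 0 := by
  rw [← h0 y]
  refine constant_of_has_deriv_right_zero (a := 0) (b := t)
    (f := fun s => P0 (fun x y => ψ x y s) y)
    (fun s _ => (hasDerivAt_P0_time hψ y s).continuousAt.continuousWithinAt) (fun s hs => ?_) t
    ⟨ht, le_rfl⟩
  rw [← h y s hs.1]
  exact (hasDerivAt_P0_time hψ y s).hasDerivWithinAt

end Slices

/-- For the two-dimensional magnetic-relaxation perturbation system (γ = 0) around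
`B = e₁`, with `a = P₀b₁`, `f = b − P₀b`, `w = v − P₀v`, and the linear and nonlinear
pressures `p_L, p_N` solving `−Δp_L = 2 ∂₂a ∂₁f₂` and `−Δp_N = 2((∂₁f₁)² + ∂₁f₂ ∂₂f₁)`,
the projected perturbation `f` satisfies `∂ₜ f = L(f) + N(f,w)` with
`L(f) = (1+a)² ∂₁²f + (1+a) ∇∂₁p_L − (∂₂a ∂₂p_L) e₁` and the nonlinearity `N` as in
the magnetic relaxation paper. -/
theorem stmt_5 (b₁ b₂ v₁ v₂ p u₁ u₂ pL pN : ℝ → ℝ → ℝ → ℝ)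
    (hb₁ : ContDiff ℝ (⊤ : ℕ∞) (fun q : ℝ × ℝ × ℝ => b₁ q.1 q.2.1 q.2.2))
    (hb₂ : ContDiff ℝ (⊤ : ℕ∞) (fun q : ℝ × ℝ × ℝ => b₂ q.1 q.2.1 q.2.2))
    (hv₁ : ContDiff ℝ (⊤ : ℕ∞) (fun q : ℝ × ℝ × ℝ => v₁ q.1 q.2.1 q.2.2))
    (hv₂ : ContDiff ℝ (⊤ : ℕ∞) (fun q : ℝ × ℝ × ℝ => v₂ q.1 q.2.1 q.2.2))
    (hp : ContDiff ℝ (⊤ : ℕ∞) (fun q : ℝ × ℝ × ℝ => p q.1 q.2.1 q.2.2))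
    (hpL : ContDiff ℝ (⊤ : ℕ∞) (fun q : ℝ × ℝ × ℝ => pL q.1 q.2.1 q.2.2))
    (hpN : ContDiff ℝ (⊤ : ℕ∞) (fun q : ℝ × ℝ × ℝ => pN q.1 q.2.1 q.2.2))
    (hper : ∀ ψ ∈ [b₁, b₂, v₁, v₂, p, pL, pN], ∀ x₁ x₂ t : ℝ,
      ψ (x₁ + 2 * π) x₂ t = ψ x₁ x₂ t ∧ ψ x₁ (x₂ + 2 * π) t = ψ x₁ x₂ t)
    (hdivb : ∀ x₁ x₂ t : ℝ, 0 ≤ t →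
      deriv (fun y => b₁ y x₂ t) x₁ + deriv (fun y => b₂ x₁ y t) x₂ = 0)
    (hdivv : ∀ x₁ x₂ t : ℝ, 0 ≤ t →
      deriv (fun y => v₁ y x₂ t) x₁ + deriv (fun y => v₂ x₁ y t) x₂ = 0)
    (hv : ∀ x₁ x₂ t : ℝ, 0 ≤ t →
      v₁ x₁ x₂ t = b₁ x₁ x₂ t * deriv (fun y => b₁ y x₂ t) x₁
          + b₂ x₁ x₂ t * deriv (fun y => b₁ x₁ y t) x₂ + deriv (fun y => p y x₂ t) x₁ ∧
      v₂ x₁ x₂ t = b₁ x₁ x₂ t * deriv (fun y => b₂ y x₂ t) x₁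
          + b₂ x₁ x₂ t * deriv (fun y => b₂ x₁ y t) x₂ + deriv (fun y => p x₁ y t) x₂)
    (hu : ∀ x₁ x₂ t : ℝ,
      u₁ x₁ x₂ t = deriv (fun y => b₁ y x₂ t) x₁ + v₁ x₁ x₂ t ∧
      u₂ x₁ x₂ t = deriv (fun y => b₂ y x₂ t) x₁ + v₂ x₁ x₂ t)
    (hevol : ∀ x₁ x₂ t : ℝ, 0 ≤ t →
      (deriv (fun s => b₁ x₁ x₂ s) t
          + u₁ x₁ x₂ t * deriv (fun y => b₁ y x₂ t) x₁
          + u₂ x₁ x₂ t * deriv (fun y => b₁ x₁ y t) x₂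
        = b₁ x₁ x₂ t * deriv (fun y => u₁ y x₂ t) x₁
          + b₂ x₁ x₂ t * deriv (fun y => u₁ x₁ y t) x₂
          + deriv (fun y => u₁ y x₂ t) x₁) ∧
      (deriv (fun s => b₂ x₁ x₂ s) t
          + u₁ x₁ x₂ t * deriv (fun y => b₂ y x₂ t) x₁
          + u₂ x₁ x₂ t * deriv (fun y => b₂ x₁ y t) x₂
        = b₁ x₁ x₂ t * deriv (fun y => u₂ y x₂ t) x₁
          + b₂ x₁ x₂ t * deriv (fun y => u₂ x₁ y t) x₂
          + deriv (fun y => u₂ y x₂ t) x₁))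
    (hinit : ∀ x₂ : ℝ, P0 (fun y₁ y₂ => b₁ y₁ y₂ 0) x₂ = 0 ∧ P0 (fun y₁ y₂ => b₂ y₁ y₂ 0) x₂ = 0)
    (a : ℝ → ℝ → ℝ) (f₁ f₂ w₁ w₂ : ℝ → ℝ → ℝ → ℝ)
    (ha : ∀ x₂ t : ℝ, a x₂ t = P0 (fun y₁ y₂ => b₁ y₁ y₂ t) x₂)
    (hf : ∀ x₁ x₂ t : ℝ,
      f₁ x₁ x₂ t = Pperp (fun y₁ y₂ => b₁ y₁ y₂ t) x₁ x₂ ∧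
      f₂ x₁ x₂ t = Pperp (fun y₁ y₂ => b₂ y₁ y₂ t) x₁ x₂)
    (hw : ∀ x₁ x₂ t : ℝ,
      w₁ x₁ x₂ t = Pperp (fun y₁ y₂ => v₁ y₁ y₂ t) x₁ x₂ ∧
      w₂ x₁ x₂ t = Pperp (fun y₁ y₂ => v₂ y₁ y₂ t) x₁ x₂)
    (hpLavg : ∀ t : ℝ, 0 ≤ t → (∫ x₂ in (-π)..π, ∫ x₁ in (-π)..π, pL x₁ x₂ t) = 0)
    (hpNavg : ∀ t : ℝ, 0 ≤ t → (∫ x₂ in (-π)..π, ∫ x₁ in (-π)..π, pN x₁ x₂ t) = 0)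
    (hpLeq : ∀ x₁ x₂ t : ℝ, 0 ≤ t →
      -(deriv (deriv (fun y => pL y x₂ t)) x₁ + deriv (deriv (fun y => pL x₁ y t)) x₂)
        = 2 * deriv (fun y => a y t) x₂ * deriv (fun y => f₂ y x₂ t) x₁)
    (hpNeq : ∀ x₁ x₂ t : ℝ, 0 ≤ t →
      -(deriv (deriv (fun y => pN y x₂ t)) x₁ + deriv (deriv (fun y => pN x₁ y t)) x₂)
        = 2 * ((deriv (fun y => f₁ y x₂ t) x₁) ^ 2
            + deriv (fun y => f₂ y x₂ t) x₁ * deriv (fun y => f₁ x₁ y t) x₂)) :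
    ∀ x₁ x₂ t : ℝ, 0 ≤ t →
      (deriv (fun s => f₁ x₁ x₂ s) t =
        ((1 + a x₂ t) ^ 2 * deriv (deriv (fun y => f₁ y x₂ t)) x₁
          + (1 + a x₂ t) * deriv (deriv (fun y => pL y x₂ t)) x₁
          - deriv (fun y => a y t) x₂ * deriv (fun y => pL x₁ y t) x₂)
        + (a x₂ t * deriv (fun y₁ => Pperp (fun z₁ z₂ =>
              f₁ z₁ z₂ t * deriv (fun r => f₁ r z₂ t) z₁
              + f₂ z₁ z₂ t * deriv (fun r => f₁ z₁ r t) z₂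
              + deriv (fun r => pN r z₂ t) z₁) y₁ x₂) x₁
          + Pperp (fun z₁ z₂ =>
              f₁ z₁ z₂ t * deriv (fun r => w₁ r z₂ t) z₁
              + f₂ z₁ z₂ t * deriv (fun r => w₁ z₁ r t) z₂
              - (w₁ z₁ z₂ t * deriv (fun r => f₁ r z₂ t) z₁
                + w₂ z₁ z₂ t * deriv (fun r => f₁ z₁ r t) z₂)) x₁ x₂
          - deriv (fun y₂ => P0 (fun z₁ z₂ => f₁ z₁ z₂ t * f₂ z₁ z₂ t) y₂) x₂
              * deriv (fun y => f₁ y x₂ t) x₁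
          + 2 * Pperp (fun z₁ z₂ =>
              f₁ z₁ z₂ t * deriv (deriv (fun r => f₁ r z₂ t)) z₁
              + f₂ z₁ z₂ t * deriv (fun r₂ => deriv (fun r => f₁ r r₂ t) z₁) z₂) x₁ x₂
          + deriv (fun y₁ => deriv (fun z₁ => Pperp (fun r₁ r₂ => pN r₁ r₂ t) z₁ x₂) y₁) x₁
          + (deriv (deriv (fun y₂ => P0 (fun z₁ z₂ => f₁ z₁ z₂ t * f₂ z₁ z₂ t) y₂)) x₂
                * f₂ x₁ x₂ t
              - deriv (fun y => a y t) x₂ * Pperp (fun z₁ z₂ =>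
                  f₁ z₁ z₂ t * deriv (fun r => f₂ r z₂ t) z₁
                  + f₂ z₁ z₂ t * deriv (fun r => f₂ z₁ r t) z₂
                  + deriv (fun r => pN z₁ r t) z₂) x₁ x₂))) ∧
      (deriv (fun s => f₂ x₁ x₂ s) t =
        ((1 + a x₂ t) ^ 2 * deriv (deriv (fun y => f₂ y x₂ t)) x₁
          + (1 + a x₂ t) * deriv (fun y₂ => deriv (fun z => pL z y₂ t) x₁) x₂)
        + (a x₂ t * deriv (fun y₁ => Pperp (fun z₁ z₂ =>
              f₁ z₁ z₂ t * deriv (fun r => f₂ r z₂ t) z₁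
              + f₂ z₁ z₂ t * deriv (fun r => f₂ z₁ r t) z₂
              + deriv (fun r => pN z₁ r t) z₂) y₁ x₂) x₁
          + Pperp (fun z₁ z₂ =>
              f₁ z₁ z₂ t * deriv (fun r => w₂ r z₂ t) z₁
              + f₂ z₁ z₂ t * deriv (fun r => w₂ z₁ r t) z₂
              - (w₁ z₁ z₂ t * deriv (fun r => f₂ r z₂ t) z₁
                + w₂ z₁ z₂ t * deriv (fun r => f₂ z₁ r t) z₂)) x₁ x₂
          - deriv (fun y₂ => P0 (fun z₁ z₂ => f₁ z₁ z₂ t * f₂ z₁ z₂ t) y₂) x₂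
              * deriv (fun y => f₂ y x₂ t) x₁
          + 2 * Pperp (fun z₁ z₂ =>
              f₁ z₁ z₂ t * deriv (deriv (fun r => f₂ r z₂ t)) z₁
              + f₂ z₁ z₂ t * deriv (fun r₂ => deriv (fun r => f₂ r r₂ t) z₁) z₂) x₁ x₂
          + deriv (fun y₂ => deriv (fun z₁ => Pperp (fun r₁ r₂ => pN r₁ r₂ t) z₁ y₂) x₁) x₂)) := by
  obtain rfl : u₁ = fun x₁ x₂ t => deriv (fun y => b₁ y x₂ t) x₁ + v₁ x₁ x₂ t :=
    funext fun x => funext fun y => funext fun t => (hu x y t).1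
  obtain rfl : u₂ = fun x₁ x₂ t => deriv (fun y => b₂ y x₂ t) x₁ + v₂ x₁ x₂ t :=
    funext fun x => funext fun y => funext fun t => (hu x y t).2
  obtain rfl : a = fun x₂ t => P0 (fun y₁ y₂ => b₁ y₁ y₂ t) x₂ :=
    funext fun y => funext fun t => ha y t
  obtain rfl : f₁ = fun x₁ x₂ t => Pperp (fun y₁ y₂ => b₁ y₁ y₂ t) x₁ x₂ :=
    funext fun x => funext fun y => funext fun t => (hf x y t).1
  obtain rfl : f₂ = fun x₁ x₂ t => Pperp (fun y₁ y₂ => b₂ y₁ y₂ t) x₁ x₂ :=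
    funext fun x => funext fun y => funext fun t => (hf x y t).2
  obtain rfl : w₁ = fun x₁ x₂ t => Pperp (fun y₁ y₂ => v₁ y₁ y₂ t) x₁ x₂ :=
    funext fun x => funext fun y => funext fun t => (hw x y t).1
  obtain rfl : w₂ = fun x₁ x₂ t => Pperp (fun y₁ y₂ => v₂ y₁ y₂ t) x₁ x₂ :=
    funext fun x => funext fun y => funext fun t => (hw x y t).2
  let β₁ := timeSlice hb₁ (hper b₁ (by simp))
  let β₂ := timeSlice hb₂ (hper b₂ (by simp))
  let ν₁ := timeSlice hv₁ (hper v₁ (by simp))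
  let ν₂ := timeSlice hv₂ (hper v₂ (by simp))
  let B₁ := timeDerivSlice hb₁ (hper b₁ (by simp))
  let B₂ := timeDerivSlice hb₂ (hper b₂ (by simp))
  let P := timeSlice hp (hper p (by simp))
  let PL := timeSlice hpL (hper pL (by simp))
  let PN := timeSlice hpN (hper pN (by simp))
  have Hb : ∀ t, 0 ≤ t → TorusFun.dx (β₁ t) + TorusFun.dy (β₂ t) = 0 := fun t ht =>
    TorusFun.ext fun x y => hdivb x y t ht
  have Hv : ∀ t, 0 ≤ t → TorusFun.dx (ν₁ t) + TorusFun.dy (ν₂ t) = 0 := fun t ht =>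
    TorusFun.ext fun x y => hdivv x y t ht
  have HB₁ : ∀ t, 0 ≤ t → B₁ t + (TorusFun.dx (β₁ t) + ν₁ t) * TorusFun.dx (β₁ t)
      + (TorusFun.dx (β₂ t) + ν₂ t) * TorusFun.dy (β₁ t)
      = β₁ t * TorusFun.dx (TorusFun.dx (β₁ t) + ν₁ t)
        + β₂ t * TorusFun.dy (TorusFun.dx (β₁ t) + ν₁ t)
        + TorusFun.dx (TorusFun.dx (β₁ t) + ν₁ t) := fun t ht =>
    TorusFun.ext fun x y => (hevol x y t ht).1
  have HB₂ : ∀ t, 0 ≤ t → B₂ t + (TorusFun.dx (β₁ t) + ν₁ t) * TorusFun.dx (β₂ t)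
      + (TorusFun.dx (β₂ t) + ν₂ t) * TorusFun.dy (β₂ t)
      = β₁ t * TorusFun.dx (TorusFun.dx (β₂ t) + ν₂ t)
        + β₂ t * TorusFun.dy (TorusFun.dx (β₂ t) + ν₂ t)
        + TorusFun.dx (TorusFun.dx (β₂ t) + ν₂ t) := fun t ht =>
    TorusFun.ext fun x y => (hevol x y t ht).2
  have HB₂0 : ∀ t, 0 ≤ t → TorusFun.avg (B₂ t) = 0 := fun t ht =>
    TorusFun.avg_evolution_snd (Hb t ht) (by
      rw [map_add, map_add, ← TorusFun.dx_dy]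
      have := congrArg TorusFun.dx (Hb t ht)
      rw [map_add, map_zero] at this
      linear_combination this + Hv t ht) (HB₂ t ht)
  have Hβ₂ : ∀ t, 0 ≤ t → TorusFun.avg (β₂ t) = 0 := fun t ht =>
    TorusFun.ext fun x y => P0_eq_zero_of_deriv_eq_zero hb₂ (fun y => (hinit y).2)
      (fun y s hs => congrFun (congrFun (congrArg Subtype.val (HB₂0 s hs)) 0) y) ht y
  intro x₁ x₂ t ht
  obtain ⟨h₁, h₂⟩ := TorusFun.projected_evolution (p := P t) (pL := PL t) (pN := PN t)
    (Hb t ht) (Hv t ht)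
    (TorusFun.ext fun x y => (hv x y t ht).1) (TorusFun.ext fun x y => (hv x y t ht).2)
    (HB₁ t ht) (HB₂ t ht) (Hβ₂ t ht) rfl rfl rfl rfl rfl rfl
    (TorusFun.ext fun x y => hpLeq x y t ht)
    (TorusFun.ext fun x y => hpNeq x y t ht)
  have e₁ := congrFun (congrFun (congrArg Subtype.val h₁) x₁) x₂
  have e₂ := congrFun (congrFun (congrArg Subtype.val h₂) x₁) x₂
  rw [deriv_Pperp_time hb₁, deriv_Pperp_time hb₂]
  exact ⟨e₁, e₂⟩
end
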